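/- arXiv:2005.07463 — 6 statements merged into one kernel-verified Lean document; each statement's English description precedes it below -/
import Mathlib

section
/- Let 𝔤 be an 8-dimensional real Lie algebra spanned by linearly independent vectors A, B, C, R, S, T, X, Y whose bracket satisfies [A,B]=2C, [C,A]=2B, [B,C]=2A, [R,S]=2T, [T,R]=2S, [S,T]=2R, such that for every E ∈ {A,B,C,R,S,T} both [E,X] and [E,Y] lie in span{A,B,C,R,S,T}, and [X,Y] lies in span{X,A,B,C,R,S,T}. Then there exist real numbers b11, b21, c11, c12, c21, c22, s14, s24, t14, t15, t24, t25, ρ such that [A,X]=−b11·B−c11·C, [A,Y]=−b21·B−c21·C, [B,X]=b11·A−c12·C, [B,Y]=b21·A−c22·C, [C,X]=c11·A+c12·B, [C,Y]=c21·A+c22·B, [R,X]=−s14·S−t14·T, [R,Y]=−s24·S−t24·T, [S,X]=s14·R−t15·T, [S,Y]=s24·R−t25·T, [T,X]=t14·R+t15·S, [T,Y]=t24·R+t25·S, and [X,Y]=ρ·X+θ₁·A+θ₂·B+θ₃·C+θ₄·R+θ₅·S+θ₆·T, where θ₁=(−ρ·c12+b11·c21−b21·c11)/2, θ₂=(ρ·c11+b11·c22−b21·c12)/2,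 θ₃=(−ρ·b11+c11·c22−c12·c21)/2, θ₄=(−ρ·t15+s14·t24−s24·t14)/2, θ₅=(ρ·t14+s14·t25−s24·t15)/2, θ₆=(−ρ·s14+t14·t25−t15·t24)/2. -/
section CommutingSu2Triples

variable {L : Type*} [LieRing L] [LieAlgebra ℝ L]

/-- Three vectors satisfying the standard relations of `su(2)`. -/
structure IsSu2Triple (A B C : L) : Prop where
  lie_AB : ⁅A, B⁆ = (2 : ℝ) • C
  lie_CA : ⁅C, A⁆ = (2 : ℝ) • B
  lie_BC : ⁅B, C⁆ = (2 : ℝ) • A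

/-- The operator `ad A ^ 2 + ad B ^ 2 + ad C ^ 2`. -/
def adSqSum (A B C : L) : L →ₗ[ℝ] L :=
  (LieAlgebra.ad ℝ L A) ^ 2 + (LieAlgebra.ad ℝ L B) ^ 2 + (LieAlgebra.ad ℝ L C) ^ 2

theorem adSqSum_apply (A B C Z : L) :
    adSqSum A B C Z = ⁅A, ⁅A, Z⁆⁆ + ⁅B, ⁅B, Z⁆⁆ + ⁅C, ⁅C, Z⁆⁆ := by
  simp [adSqSum, pow_two]

theorem adSqSum_rotate (A B C : L) : adSqSum B C A = adSqSum A B C := by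
  simp only [adSqSum]
  abel

theorem adSqSum_lie_of_commute {A B C U : L} (hA : ⁅A, U⁆ = 0) (hB : ⁅B, U⁆ = 0)
    (hC : ⁅C, U⁆ = 0) (Z : L) : adSqSum A B C ⁅U, Z⁆ = ⁅U, adSqSum A B C Z⁆ := by
  have key (V : L) (hV : ⁅V, U⁆ = 0) (W : L) : ⁅V, ⁅U, W⁆⁆ = ⁅U, ⁅V, W⁆⁆ := by
    rw [leibniz_lie V U W, hV, zero_lie, zero_add]
  simp only [adSqSum_apply, key A hA, key B hB, key C hC, lie_add]

theorem adSqSum_eq_zero {A B C Z : L} (hA : ⁅A, Z⁆ = 0) (hB : ⁅B, Z⁆ = 0) (hC : ⁅C, Z⁆ = 0) :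
    adSqSum A B C Z = 0 := by
  simp [adSqSum_apply, hA, hB, hC]

namespace IsSu2Triple

variable {A B C : L}

theorem rotate (h : IsSu2Triple A B C) : IsSu2Triple B C A :=
  ⟨h.lie_BC, h.lie_AB, h.lie_CA⟩

theorem lie_BA (h : IsSu2Triple A B C) : ⁅B, A⁆ = -((2 : ℝ) • C) := by
  rw [← lie_skew, h.lie_AB]

theorem lie_AC (h : IsSu2Triple A B C) : ⁅A, C⁆ = -((2 : ℝ) • B) := by
  rw [← lie_skew, h.lie_CA]

theorem adSqSum_self (h : IsSu2Triple A B C) : adSqSum A B C A = (-8 : ℝ) • A := by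
  simp only [adSqSum_apply, lie_self, lie_zero, h.lie_BA, h.lie_CA, lie_neg, lie_smul, h.lie_BC,
    h.rotate.lie_BA]
  module

theorem adSqSum_lie (h : IsSu2Triple A B C) (Z : L) :
    adSqSum A B C ⁅A, Z⁆ = ⁅A, adSqSum A B C Z⁆ := by
  have hB (W : L) : ⁅A, ⁅B, W⁆⁆ = (2 : ℝ) • ⁅C, W⁆ + ⁅B, ⁅A, W⁆⁆ := by
    rw [leibniz_lie, h.lie_AB, smul_lie]
  have hC (W : L) : ⁅A, ⁅C, W⁆⁆ = -((2 : ℝ) • ⁅B, W⁆) + ⁅C, ⁅A, W⁆⁆ := by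
    rw [leibniz_lie, h.lie_AC, neg_lie, smul_lie]
  simp only [adSqSum_apply, lie_add, hB, hC, lie_neg, lie_smul]
  module

end IsSu2Triple

/-- Two mutually commuting `su(2)`-triples. -/
structure IsSu2Pair (A B C R S T : L) : Prop where
  left : IsSu2Triple A B C
  right : IsSu2Triple R S T
  commute : ∀ U ∈ ({A, B, C} : Set L), ∀ V ∈ ({R, S, T} : Set L), ⁅U, V⁆ = 0

namespace IsSu2Pair

variable {A B C R S T : L}

theorem symm (h : IsSu2Pair A B C R S T) : IsSu2Pair R S T A B C :=
  ⟨h.right, h.left, fun U hU V hV => by rw [← lie_skew, h.commute V hV U hU, neg_zero]⟩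

theorem rotate (h : IsSu2Pair A B C R S T) : IsSu2Pair B C A R S T :=
  ⟨h.left.rotate, h.right, fun U hU V hV => h.commute U (by simp at hU ⊢; tauto) V hV⟩

theorem adSqSum_lie_first (h : IsSu2Pair A B C R S T) (Z : L) :
    (adSqSum A B C + adSqSum R S T) ⁅A, Z⁆ = ⁅A, (adSqSum A B C + adSqSum R S T) Z⁆ := by
  rw [LinearMap.add_apply, LinearMap.add_apply, lie_add, h.left.adSqSum_lie,
    adSqSum_lie_of_commute] <;> exact h.symm.commute _ (by simp) _ (by simp)

theorem adSqSum_first (h : IsSu2Pair A B C R S T) :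
    (adSqSum A B C + adSqSum R S T) A = (-8 : ℝ) • A := by
  rw [LinearMap.add_apply, h.left.adSqSum_self, adSqSum_eq_zero, add_zero] <;>
    exact h.symm.commute _ (by simp) _ (by simp)

theorem adSqSum_lie (h : IsSu2Pair A B C R S T) {E : L} (hE : E ∈ ({A, B, C, R, S, T} : Set L))
    (Z : L) : (adSqSum A B C + adSqSum R S T) ⁅E, Z⁆ = ⁅E, (adSqSum A B C + adSqSum R S T) Z⁆ := by
  have hB := h.rotate.adSqSum_lie_first Z
  have hC := h.rotate.rotate.adSqSum_lie_first Z
  have hR := h.symm.adSqSum_lie_first Z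
  have hS := h.symm.rotate.adSqSum_lie_first Z
  have hT := h.symm.rotate.rotate.adSqSum_lie_first Z
  simp only [adSqSum_rotate, add_comm (adSqSum R S T)] at hB hC hR hS hT
  simp only [Set.mem_insert_iff, Set.mem_singleton_iff] at hE
  rcases hE with rfl | rfl | rfl | rfl | rfl | rfl
  exacts [h.adSqSum_lie_first Z, hB, hC, hR, hS, hT]

theorem adSqSum_of_mem_span (h : IsSu2Pair A B C R S T) {W : L}
    (hW : W ∈ Submodule.span ℝ ({A, B, C, R, S, T} : Set L)) :
    (adSqSum A B C + adSqSum R S T) W = (-8 : ℝ) • W := by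
  have hB := h.rotate.adSqSum_first
  have hC := h.rotate.rotate.adSqSum_first
  have hR := h.symm.adSqSum_first
  have hS := h.symm.rotate.adSqSum_first
  have hT := h.symm.rotate.rotate.adSqSum_first
  simp only [adSqSum_rotate, add_comm (adSqSum R S T)] at hB hC hR hS hT
  induction hW using Submodule.span_induction with
  | mem E hE =>
    simp only [Set.mem_insert_iff, Set.mem_singleton_iff] at hE
    rcases hE with rfl | rfl | rfl | rfl | rfl | rfl
    exacts [h.adSqSum_first, hB, hC, hR, hS, hT]
  | zero => simp
  | add U V _ _ hU hV => rw [map_add, hU, hV, smul_add]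
  | smul r U _ hU => rw [map_smul, hU, smul_comm]

/-- The span of the two triples has trivial centre. -/
theorem eq_zero_of_lie_eq_zero (h : IsSu2Pair A B C R S T) {W : L}
    (hW : W ∈ Submodule.span ℝ ({A, B, C, R, S, T} : Set L))
    (hcomm : ∀ E ∈ ({A, B, C, R, S, T} : Set L), ⁅E, W⁆ = 0) : W = 0 := by
  have h8 := h.adSqSum_of_mem_span hW
  rw [LinearMap.add_apply, adSqSum_eq_zero, adSqSum_eq_zero, add_zero] at h8
  · simpa using h8.symm
  all_goals exact hcomm _ (by simp)

theorem lie_mem_span (h : IsSu2Pair A B C R S T) {E W : L}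
    (hE : E ∈ ({A, B, C, R, S, T} : Set L))
    (hW : W ∈ Submodule.span ℝ ({A, B, C, R, S, T} : Set L)) :
    ⁅E, W⁆ ∈ Submodule.span ℝ ({A, B, C, R, S, T} : Set L) := by
  have hmem : ∀ E ∈ ({A, B, C, R, S, T} : Set L),
      E ∈ Submodule.span ℝ ({A, B, C, R, S, T} : Set L) := fun E hE => Submodule.subset_span hE
  have hlr := h.commute
  have hrl := h.symm.commute
  simp only [Set.mem_insert_iff, Set.mem_singleton_iff, forall_eq_or_imp, forall_eq] at hmem hlr hrl
  induction hW using Submodule.span_induction with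
  | mem F hF =>
    simp only [Set.mem_insert_iff, Set.mem_singleton_iff] at hE hF
    rcases hE with rfl | rfl | rfl | rfl | rfl | rfl <;>
      rcases hF with rfl | rfl | rfl | rfl | rfl | rfl <;>
      simp [h.left.lie_AB, h.left.lie_BA, h.left.lie_CA, h.left.lie_AC, h.left.lie_BC,
        h.left.rotate.lie_BA, h.right.lie_AB, h.right.lie_BA, h.right.lie_CA, h.right.lie_AC,
        h.right.lie_BC, h.right.rotate.lie_BA, hlr, hrl, hmem]
  | zero => simp
  | add U V _ _ hU hV => rw [lie_add]; exact add_mem hU hV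
  | smul r U _ hU => rw [lie_smul]; exact Submodule.smul_mem _ _ hU

theorem span_lie_mem_span (h : IsSu2Pair A B C R S T) {V W : L}
    (hV : V ∈ Submodule.span ℝ ({A, B, C, R, S, T} : Set L))
    (hW : W ∈ Submodule.span ℝ ({A, B, C, R, S, T} : Set L)) :
    ⁅V, W⁆ ∈ Submodule.span ℝ ({A, B, C, R, S, T} : Set L) := by
  induction hV using Submodule.span_induction with
  | mem E hE => exact h.lie_mem_span hE hW
  | zero => simp
  | add U V _ _ hU hV => rw [add_lie]; exact add_mem hU hV
  | smul r U _ hU => rw [smul_lie]; exact Submodule.smul_mem _ _ hU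

/-- A vector normalizing the span of the two triples acts on it as an element of that span. -/
theorem exists_lie_sub_eq_zero (h : IsSu2Pair A B C R S T) {X : L}
    (hX : ∀ E ∈ ({A, B, C, R, S, T} : Set L),
      ⁅E, X⁆ ∈ Submodule.span ℝ ({A, B, C, R, S, T} : Set L)) :
    ∃ D ∈ Submodule.span ℝ ({A, B, C, R, S, T} : Set L),
      ∀ E ∈ ({A, B, C, R, S, T} : Set L), ⁅E, X - D⁆ = 0 := by
  set Ω := adSqSum A B C + adSqSum R S T with hΩ
  have hmem : (-1 / 8 : ℝ) • Ω X ∈ Submodule.span ℝ ({A, B, C, R, S, T} : Set L) := by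
    have hsq (E : L) (hE : E ∈ ({A, B, C, R, S, T} : Set L)) := h.lie_mem_span hE (hX E hE)
    refine Submodule.smul_mem _ _ ?_
    rw [hΩ, LinearMap.add_apply, adSqSum_apply, adSqSum_apply]
    refine add_mem (add_mem (add_mem ?_ ?_) ?_) (add_mem (add_mem ?_ ?_) ?_) <;>
      exact hsq _ (by simp)
  refine ⟨_, hmem, fun E hE => ?_⟩
  have hzero : Ω (X - (-1 / 8 : ℝ) • Ω X) = 0 := by
    rw [map_sub, h.adSqSum_of_mem_span hmem]
    module
  have hlie : ⁅E, X - (-1 / 8 : ℝ) • Ω X⁆ ∈ Submodule.span ℝ ({A, B, C, R, S, T} : Set L) := by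
    rw [lie_sub]
    exact sub_mem (hX E hE) (h.lie_mem_span hE hmem)
  have h8 := h.adSqSum_of_mem_span hlie
  rw [h.adSqSum_lie hE, ← hΩ, hzero, lie_zero] at h8
  simpa using h8.symm

end IsSu2Pair

theorem lie_eq_zero_of_mem_span {s : Set L} {Z W : L} (hs : ∀ E ∈ s, ⁅E, Z⁆ = 0)
    (hW : W ∈ Submodule.span ℝ s) : ⁅W, Z⁆ = 0 := by
  induction hW using Submodule.span_induction with
  | mem E hE => exact hs E hE
  | zero => simp
  | add U V _ _ hU hV => rw [add_lie, hU, hV, add_zero]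
  | smul r U _ hU => rw [smul_lie, hU, smul_zero]

theorem exists_coeffs_of_mem_span {A B C R S T W : L}
    (hW : W ∈ Submodule.span ℝ ({A, B, C, R, S, T} : Set L)) :
    ∃ a b c r s t : ℝ, W = a • A + b • B + c • C + r • R + s • S + t • T := by
  simp only [Submodule.mem_span_insert, Submodule.mem_span_singleton] at hW
  obtain ⟨a, _, ⟨b, _, ⟨c, _, ⟨r, _, ⟨s, _, ⟨t, rfl⟩, rfl⟩, rfl⟩, rfl⟩, rfl⟩, rfl⟩ := hW
  exact ⟨a, b, c, r, s, t, by abel⟩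

end CommutingSu2Triples

theorem stmt_2 {L : Type*} [LieRing L] [LieAlgebra ℝ L]
    (A B C R S T X Y : L)
    (hindep : LinearIndependent ℝ ![A, B, C, R, S, T, X, Y])
    (hspan : Submodule.span ℝ ({A, B, C, R, S, T, X, Y} : Set L) = ⊤)
    (hAB : ⁅A, B⁆ = (2:ℝ) • C)
    (hCA : ⁅C, A⁆ = (2:ℝ) • B)
    (hBC : ⁅B, C⁆ = (2:ℝ) • A)
    (hRS : ⁅R, S⁆ = (2:ℝ) • T)
    (hTR : ⁅T, R⁆ = (2:ℝ) • S)
    (hST : ⁅S, T⁆ = (2:ℝ) • R)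
    (hAR : ⁅A, R⁆ = 0)
    (hAS : ⁅A, S⁆ = 0)
    (hAT : ⁅A, T⁆ = 0)
    (hBR : ⁅B, R⁆ = 0)
    (hBS : ⁅B, S⁆ = 0)
    (hBT : ⁅B, T⁆ = 0)
    (hCR : ⁅C, R⁆ = 0)
    (hCS : ⁅C, S⁆ = 0)
    (hCT : ⁅C, T⁆ = 0)
    (mAX : ⁅A, X⁆ ∈ Submodule.span ℝ ({A, B, C, R, S, T} : Set L))
    (mAY : ⁅A, Y⁆ ∈ Submodule.span ℝ ({A, B, C, R, S, T} : Set L))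
    (mBX : ⁅B, X⁆ ∈ Submodule.span ℝ ({A, B, C, R, S, T} : Set L))
    (mBY : ⁅B, Y⁆ ∈ Submodule.span ℝ ({A, B, C, R, S, T} : Set L))
    (mCX : ⁅C, X⁆ ∈ Submodule.span ℝ ({A, B, C, R, S, T} : Set L))
    (mCY : ⁅C, Y⁆ ∈ Submodule.span ℝ ({A, B, C, R, S, T} : Set L))
    (mRX : ⁅R, X⁆ ∈ Submodule.span ℝ ({A, B, C, R, S, T} : Set L))
    (mRY : ⁅R, Y⁆ ∈ Submodule.span ℝ ({A, B, C, R, S, T} : Set L))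
    (mSX : ⁅S, X⁆ ∈ Submodule.span ℝ ({A, B, C, R, S, T} : Set L))
    (mSY : ⁅S, Y⁆ ∈ Submodule.span ℝ ({A, B, C, R, S, T} : Set L))
    (mTX : ⁅T, X⁆ ∈ Submodule.span ℝ ({A, B, C, R, S, T} : Set L))
    (mTY : ⁅T, Y⁆ ∈ Submodule.span ℝ ({A, B, C, R, S, T} : Set L))
    (mXY : ⁅X, Y⁆ ∈ Submodule.span ℝ ({X, A, B, C, R, S, T} : Set L)) :
    ∃ b11 b21 c11 c12 c21 c22 s14 s24 t14 t15 t24 t25 ρ : ℝ,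
      ⁅A, X⁆ = -(b11 • B) - c11 • C ∧
      ⁅A, Y⁆ = -(b21 • B) - c21 • C ∧
      ⁅B, X⁆ = b11 • A - c12 • C ∧
      ⁅B, Y⁆ = b21 • A - c22 • C ∧
      ⁅C, X⁆ = c11 • A + c12 • B ∧
      ⁅C, Y⁆ = c21 • A + c22 • B ∧
      ⁅R, X⁆ = -(s14 • S) - t14 • T ∧
      ⁅R, Y⁆ = -(s24 • S) - t24 • T ∧
      ⁅S, X⁆ = s14 • R - t15 • T ∧
      ⁅S, Y⁆ = s24 • R - t25 • T ∧
      ⁅T, X⁆ = t14 • R + t15 • S ∧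
      ⁅T, Y⁆ = t24 • R + t25 • S ∧
      ⁅X, Y⁆ = ρ • X + ((-ρ*c12 + b11*c21 - b21*c11)/2) • A + ((ρ*c11 + b11*c22 - b21*c12)/2) • B +
      ((-ρ*b11 + c11*c22 - c12*c21)/2) • C + ((-ρ*t15 + s14*t24 - s24*t14)/2) • R +
      ((ρ*t14 + s14*t25 - s24*t15)/2) • S + ((-ρ*s14 + t14*t25 - t15*t24)/2) • T := by
  have h : IsSu2Pair A B C R S T := by
    refine ⟨⟨hAB, hCA, hBC⟩, ⟨hRS, hTR, hST⟩, ?_⟩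
    simp [hAR, hAS, hAT, hBR, hBS, hBT, hCR, hCS, hCT]
  obtain ⟨D, hD, hXD⟩ := h.exists_lie_sub_eq_zero (X := X) (by simp [mAX, mBX, mCX, mRX, mSX, mTX])
  obtain ⟨F, hF, hYF⟩ := h.exists_lie_sub_eq_zero (X := Y) (by simp [mAY, mBY, mCY, mRY, mSY, mTY])
  obtain ⟨ρ, H, hH, hXY⟩ := Submodule.mem_span_insert.mp mXY
  have hBA := h.left.lie_BA
  have hAC := h.left.lie_AC
  have hCB := h.left.rotate.lie_BA
  have hSR := h.right.lie_BA
  have hRT := h.right.lie_AC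
  have hTS := h.right.rotate.lie_BA
  have hcomm := h.symm.commute
  simp only [Set.mem_insert_iff, Set.mem_singleton_iff, forall_eq_or_imp, forall_eq] at hcomm
  have hDE (E : L) (hE : E ∈ ({A, B, C, R, S, T} : Set L)) : ⁅E, X⁆ = ⁅E, D⁆ := by
    rw [← sub_eq_zero, ← lie_sub, hXD E hE]
  have hFE (E : L) (hE : E ∈ ({A, B, C, R, S, T} : Set L)) : ⁅E, Y⁆ = ⁅E, F⁆ := by
    rw [← sub_eq_zero, ← lie_sub, hYF E hE]
  have hDF : ⁅D, F⁆ ∈ Submodule.span ℝ ({A, B, C, R, S, T} : Set L) := h.span_lie_mem_span hD hF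
  have hsplit : ⁅X - D, Y - F⁆ = ρ • (X - D) + (ρ • D + H - ⁅D, F⁆) := by
    have h1 := lie_eq_zero_of_mem_span hXD hF
    have h2 := lie_eq_zero_of_mem_span hYF hD
    rw [← lie_skew, neg_eq_zero, sub_lie, sub_eq_zero] at h1
    rw [lie_sub, sub_eq_zero] at h2
    rw [sub_lie, lie_sub, lie_sub, h1, h2, hXY]
    module
  have hHeq : ρ • D + H - ⁅D, F⁆ = 0 := by
    refine h.eq_zero_of_lie_eq_zero
      (sub_mem (add_mem (Submodule.smul_mem _ _ hD) hH) hDF) fun E hE => ?_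
    rw [eq_sub_of_add_eq' hsplit.symm, lie_sub, lie_smul, hXD E hE, leibniz_lie, hXD E hE,
      hYF E hE]
    simp
  obtain ⟨d₁, d₂, d₃, d₄, d₅, d₆, rfl⟩ := exists_coeffs_of_mem_span hD
  obtain ⟨f₁, f₂, f₃, f₄, f₅, f₆, rfl⟩ := exists_coeffs_of_mem_span hF
  have hH' := eq_sub_of_add_eq' (sub_eq_zero.mp hHeq)
  refine ⟨2 * d₃, 2 * f₃, -2 * d₂, 2 * d₁, -2 * f₂, 2 * f₁, 2 * d₆, 2 * f₆, -2 * d₅, 2 * d₄,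
    -2 * f₅, 2 * f₄, ρ, ?_, ?_, ?_, ?_, ?_, ?_, ?_, ?_, ?_, ?_, ?_, ?_, ?_⟩
  on_goal 13 => rw [hXY, hH']
  all_goals
    first
    | rw [hDE _ (by simp)]
    | rw [hFE _ (by simp)]
    | skip
    simp only [lie_add, add_lie, lie_smul, smul_lie, lie_self, hAB, hCA, hBC, hRS, hTR, hST, hBA,
      hAC, hCB, hSR, hRT, hTS, hAR, hAS, hAT, hBR, hBS, hBT, hCR, hCS, hCT, hcomm]
    module
end

section
/- For every choice of real parameters b11, b21, c11, c12, c21, c22, s14, s24, t14, t15, t24, t25, ρ, the antisymmetric bilinear bracket on the 8-dimensional real vector space with basis {A,B,C,R,S,T,X,Y} defined by the su(2)⊕su(2)-relations [A,B]=2C, [C,A]=2B, [B,C]=2A, [R,S]=2T, [T,R]=2S, [S,T]=2R together with [A,X]=−b11·B−c11·C, [A,Y]=−b21·B−c21·C, [B,X]=b11·A−c12·C, [B,Y]=b21·A−c22·C, [C,X]=c11·A+c12·B, [C,Y]=c21·A+c22·B, [R,X]=−s14·S−t14·T, [R,Y]=−s24·S−t24·T, [S,X]=s14·R−t15·T, [S,Y]=s24·R−t25·T,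 [T,X]=t14·R+t15·S, [T,Y]=t24·R+t25·S, [X,Y]=ρ·X+θ₁·A+θ₂·B+θ₃·C+θ₄·R+θ₅·S+θ₆·T satisfies the Jacobi identity, and hence defines an 8-dimensional real Lie algebra containing span{A,B,C,R,S,T} ≅ su(2)⊕su(2) as a Lie subalgebra of codimension two. -/
/-- An 8-dimensional real Lie algebra realising the given bracket relations:
the Jacobi identity holds (it is a `LieRing`), the eight listed elements form a basis,
and the span of `A, B, C, R, S, T` is a Lie subalgebra of codimension two. -/
structure SU2xSU2Family (b11 b21 c11 c12 c21 c22 s14 s24 t14 t15 t24 t25 ρ : ℝ) where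
  L : Type
  [lieRing : LieRing L]
  [lieAlgebra : LieAlgebra ℝ L]
  A : L
  B : L
  C : L
  R : L
  S : L
  T : L
  X : L
  Y : L
  indep : LinearIndependent ℝ ![A, B, C, R, S, T, X, Y]
  span_top : Submodule.span ℝ ({A, B, C, R, S, T, X, Y} : Set L) = ⊤
  codim_two : Module.finrank ℝ (L ⧸ Submodule.span ℝ ({A, B, C, R, S, T} : Set L)) = 2
  hAB : ⁅A, B⁆ = (2:ℝ) • C
  hCA : ⁅C, A⁆ = (2:ℝ) • B
  hBC : ⁅B, C⁆ = (2:ℝ) • A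
  hRS : ⁅R, S⁆ = (2:ℝ) • T
  hTR : ⁅T, R⁆ = (2:ℝ) • S
  hST : ⁅S, T⁆ = (2:ℝ) • R
  hAR : ⁅A, R⁆ = 0
  hAS : ⁅A, S⁆ = 0
  hAT : ⁅A, T⁆ = 0
  hBR : ⁅B, R⁆ = 0
  hBS : ⁅B, S⁆ = 0
  hBT : ⁅B, T⁆ = 0
  hCR : ⁅C, R⁆ = 0
  hCS : ⁅C, S⁆ = 0
  hCT : ⁅C, T⁆ = 0
  hAX : ⁅A, X⁆ = -(b11 • B) - c11 • C
  hAY : ⁅A, Y⁆ = -(b21 • B) - c21 • C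
  hBX : ⁅B, X⁆ = b11 • A - c12 • C
  hBY : ⁅B, Y⁆ = b21 • A - c22 • C
  hCX : ⁅C, X⁆ = c11 • A + c12 • B
  hCY : ⁅C, Y⁆ = c21 • A + c22 • B
  hRX : ⁅R, X⁆ = -(s14 • S) - t14 • T
  hRY : ⁅R, Y⁆ = -(s24 • S) - t24 • T
  hSX : ⁅S, X⁆ = s14 • R - t15 • T
  hSY : ⁅S, Y⁆ = s24 • R - t25 • T
  hTX : ⁅T, X⁆ = t14 • R + t15 • S
  hTY : ⁅T, Y⁆ = t24 • R + t25 • S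
  hXY : ⁅X, Y⁆ = ρ • X + ((-ρ*c12 + b11*c21 - b21*c11)/2) • A + ((ρ*c11 + b11*c22 - b21*c12)/2) • B +
      ((-ρ*b11 + c11*c22 - c12*c21)/2) • C + ((-ρ*t15 + s14*t24 - s24*t14)/2) • R +
      ((ρ*t14 + s14*t25 - s24*t15)/2) • S + ((-ρ*s14 + t14*t25 - t15*t24)/2) • T

/-- The Lie algebra `su(2) ⊕ su(2) ⊕ 𝔯`, where `𝔯` is the two-dimensional Lie algebra with
basis `x, y` and bracket `⁅x, y⁆ = ρ • x`, on the underlying space `ℝ⁸`. -/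
def SplitLieAlgebra (_ρ : ℝ) : Type := Fin 8 → ℝ

namespace SplitLieAlgebra

variable {ρ : ℝ}

noncomputable instance : AddCommGroup (SplitLieAlgebra ρ) :=
  inferInstanceAs (AddCommGroup (Fin 8 → ℝ))

noncomputable instance : Module ℝ (SplitLieAlgebra ρ) :=
  inferInstanceAs (Module ℝ (Fin 8 → ℝ))

instance : Module.Finite ℝ (SplitLieAlgebra ρ) :=
  inferInstanceAs (Module.Finite ℝ (Fin 8 → ℝ))

theorem finrank_eq : Module.finrank ℝ (SplitLieAlgebra ρ) = 8 :=
  (Module.finrank_fin_fun ℝ : Module.finrank ℝ (Fin 8 → ℝ) = 8)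

/-- The element with the given coordinates. -/
def mk (v : Fin 8 → ℝ) : SplitLieAlgebra ρ := v

/-- The coordinates of an element. -/
def coord (x : SplitLieAlgebra ρ) : Fin 8 → ℝ := x

@[ext]
theorem ext {x y : SplitLieAlgebra ρ} (h : ∀ i, x.coord i = y.coord i) : x = y := funext h

@[simp] theorem coord_mk (v : Fin 8 → ℝ) : (mk v : SplitLieAlgebra ρ).coord = v := rfl
@[simp] theorem coord_zero : (0 : SplitLieAlgebra ρ).coord = 0 := rfl
@[simp] theorem coord_add (x y : SplitLieAlgebra ρ) : (x + y).coord = x.coord + y.coord := rfl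
@[simp] theorem coord_neg (x : SplitLieAlgebra ρ) : (-x).coord = -x.coord := rfl
@[simp] theorem coord_sub (x y : SplitLieAlgebra ρ) : (x - y).coord = x.coord - y.coord := rfl
@[simp] theorem coord_smul (a : ℝ) (x : SplitLieAlgebra ρ) : (a • x).coord = a • x.coord := rfl

noncomputable instance : Bracket (SplitLieAlgebra ρ) (SplitLieAlgebra ρ) where
  bracket x y := mk
    ![2 * (x.coord 1 * y.coord 2 - x.coord 2 * y.coord 1),
      2 * (x.coord 2 * y.coord 0 - x.coord 0 * y.coord 2),
      2 * (x.coord 0 * y.coord 1 - x.coord 1 * y.coord 0),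
      2 * (x.coord 4 * y.coord 5 - x.coord 5 * y.coord 4),
      2 * (x.coord 5 * y.coord 3 - x.coord 3 * y.coord 5),
      2 * (x.coord 3 * y.coord 4 - x.coord 4 * y.coord 3),
      ρ * (x.coord 6 * y.coord 7 - x.coord 7 * y.coord 6),
      0]

theorem coord_lie (x y : SplitLieAlgebra ρ) : ⁅x, y⁆.coord =
    ![2 * (x.coord 1 * y.coord 2 - x.coord 2 * y.coord 1),
      2 * (x.coord 2 * y.coord 0 - x.coord 0 * y.coord 2),
      2 * (x.coord 0 * y.coord 1 - x.coord 1 * y.coord 0),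
      2 * (x.coord 4 * y.coord 5 - x.coord 5 * y.coord 4),
      2 * (x.coord 5 * y.coord 3 - x.coord 3 * y.coord 5),
      2 * (x.coord 3 * y.coord 4 - x.coord 4 * y.coord 3),
      ρ * (x.coord 6 * y.coord 7 - x.coord 7 * y.coord 6),
      0] := rfl

noncomputable instance : LieRing (SplitLieAlgebra ρ) where
  add_lie x y z := by
    ext i; fin_cases i <;> simp [coord_lie] <;> ring
  lie_add x y z := by
    ext i; fin_cases i <;> simp [coord_lie] <;> ring
  lie_self x := by
    ext i; fin_cases i <;> simp [coord_lie, mul_comm]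
  leibniz_lie x y z := by
    ext i; fin_cases i <;> simp [coord_lie] <;> ring

noncomputable instance : LieAlgebra ℝ (SplitLieAlgebra ρ) where
  lie_smul a x y := by
    ext i; fin_cases i <;> simp [coord_lie] <;> ring

/-- The six standard vectors spanning `su(2) ⊕ su(2)`, followed by lifts of the basis of `𝔯`
with components `u` and `v` in `su(2) ⊕ su(2)`, are linearly independent. -/
theorem linearIndependent_lift (u v : Fin 6 → ℝ) :
    LinearIndependent ℝ (![mk ![1, 0, 0, 0, 0, 0, 0, 0], mk ![0, 1, 0, 0, 0, 0, 0, 0],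
      mk ![0, 0, 1, 0, 0, 0, 0, 0], mk ![0, 0, 0, 1, 0, 0, 0, 0],
      mk ![0, 0, 0, 0, 1, 0, 0, 0], mk ![0, 0, 0, 0, 0, 1, 0, 0],
      mk ![u 0, u 1, u 2, u 3, u 4, u 5, 1, 0],
      mk ![v 0, v 1, v 2, v 3, v 4, v 5, 0, 1]] : Fin 8 → SplitLieAlgebra ρ) := by
  rw [Fintype.linearIndependent_iff]
  intro g hg
  have h : ∀ i, _ = (0 : ℝ) := fun i => congrFun (congrArg coord hg) i
  simp only [Fin.sum_univ_eight] at h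
  have h6 : g 6 = 0 := by simpa using h 6
  have h7 : g 7 = 0 := by simpa using h 7
  intro i
  fin_cases i
  · simpa [h6, h7] using h 0
  · simpa [h6, h7] using h 1
  · simpa [h6, h7] using h 2
  · simpa [h6, h7] using h 3
  · simpa [h6, h7] using h 4
  · simpa [h6, h7] using h 5
  · exact h6
  · exact h7

end SplitLieAlgebra

theorem span_eq_top_of_linearIndependent_eight {L : Type*} [AddCommGroup L] [Module ℝ L]
    (hL : Module.finrank ℝ L = 8) {A B C R S T X Y : L}
    (h : LinearIndependent ℝ ![A, B, C, R, S, T, X, Y]) :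
    Submodule.span ℝ ({A, B, C, R, S, T, X, Y} : Set L) = ⊤ := by
  have := h.span_eq_top_of_card_eq_finrank (by simp [hL])
  simpa only [Matrix.range_cons, Matrix.range_empty, Set.union_empty,
    Set.singleton_union] using this

theorem finrank_quotient_span_of_linearIndependent_eight {L : Type*} [AddCommGroup L] [Module ℝ L]
    [Module.Finite ℝ L] (hL : Module.finrank ℝ L = 8) {A B C R S T X Y : L}
    (h : LinearIndependent ℝ ![A, B, C, R, S, T, X, Y]) :
    Module.finrank ℝ (L ⧸ Submodule.span ℝ ({A, B, C, R, S, T} : Set L)) = 2 := by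
  have h6 : LinearIndependent ℝ ![A, B, C, R, S, T] := by
    convert h.comp (Fin.castLE (Nat.le_add_right 6 2)) (Fin.castLE_injective _) using 1
    funext i
    fin_cases i <;> rfl
  have hspan := finrank_span_eq_card h6
  have hrange : Set.range ![A, B, C, R, S, T] = {A, B, C, R, S, T} := by
    simp only [Matrix.range_cons, Matrix.range_empty, Set.union_empty, Set.singleton_union]
  rw [hrange, Fintype.card_fin] at hspan
  have := Submodule.finrank_quotient_add_finrank
    (Submodule.span ℝ ({A, B, C, R, S, T} : Set L))
  omega

open SplitLieAlgebra in
theorem stmt_3 (b11 b21 c11 c12 c21 c22 s14 s24 t14 t15 t24 t25 ρ : ℝ) :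
    Nonempty (SU2xSU2Family b11 b21 c11 c12 c21 c22 s14 s24 t14 t15 t24 t25 ρ) := by
  have indep := linearIndependent_lift (ρ := ρ)
    ![c12 / 2, -c11 / 2, b11 / 2, t15 / 2, -t14 / 2, s14 / 2]
    ![c22 / 2, -c21 / 2, b21 / 2, t25 / 2, -t24 / 2, s24 / 2]
  refine ⟨SU2xSU2Family.mk (SplitLieAlgebra ρ) _ _ _ _ _ _ _ _ indep
    (span_eq_top_of_linearIndependent_eight finrank_eq indep)
    (finrank_quotient_span_of_linearIndependent_eight finrank_eq indep)
    ?_ ?_ ?_ ?_ ?_ ?_ ?_ ?_ ?_ ?_ ?_ ?_ ?_ ?_ ?_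
    ?_ ?_ ?_ ?_ ?_ ?_ ?_ ?_ ?_ ?_ ?_ ?_ ?_⟩
  all_goals
    ext i
    fin_cases i <;> simp [coord_lie] <;> ring
end

section
/- Let 𝔤 be an 8-dimensional real Lie algebra spanned by linearly independent vectors A, B, C, R, S, T, X, Y whose bracket satisfies [A,B]=2C, [C,A]=2B, [B,C]=2A, [R,S]=2T, [T,R]=2S, [S,T]=−2R, such that for every E ∈ {A,B,C,R,S,T} both [E,X] and [E,Y] lie in span{A,B,C,R,S,T}, and [X,Y] lies in span{X,A,B,C,R,S,T}. Then there exist real numbers b11, b21, c11, c12, c21, c22, s14, s24, t14, t15, t24, t25, ρ such that [A,X]=−b11·B−c11·C, [A,Y]=−b21·B−c21·C, [B,X]=b11·A−c12·C, [B,Y]=b21·A−c22·C, [C,X]=c11·A+c12·B, [C,Y]=c21·A+c22·B, [R,X]=s14·S+t14·T, [R,Y]=s24·S+t24·T, [S,X]=s14·R−t15·T, [S,Y]=s24·R−t25·T, [T,X]=t14·R+t15·S, [T,Y]=t24·R+t25·S, and [X,Y]=ρ·X+θ₁·A+θ₂·B+θ₃·C+θ₄·R+θ₅·S+θ₆·T,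 where θ₁=(−ρ·c12+b11·c21−b21·c11)/2, θ₂=(ρ·c11+b11·c22−b21·c12)/2, θ₃=(−ρ·b11+c11·c22−c12·c21)/2, θ₄=(−ρ·t15−s14·t24+s24·t14)/2, θ₅=(−ρ·t14−s14·t25+s24·t15)/2, θ₆=(ρ·s14−t14·t25+t15·t24)/2. -/
/-- The standard bracket relations of `su(2) ⊕ sl(2,ℝ)` on six vectors of a real Lie algebra. -/
structure IsSu2Sl2Sextuple {L : Type*} [LieRing L] [LieAlgebra ℝ L] (A B C R S T : L) : Prop where
  AB : ⁅A, B⁆ = (2:ℝ) • C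
  CA : ⁅C, A⁆ = (2:ℝ) • B
  BC : ⁅B, C⁆ = (2:ℝ) • A
  RS : ⁅R, S⁆ = (2:ℝ) • T
  TR : ⁅T, R⁆ = (2:ℝ) • S
  ST : ⁅S, T⁆ = -((2:ℝ) • R)
  AR : ⁅A, R⁆ = 0
  AS : ⁅A, S⁆ = 0
  AT : ⁅A, T⁆ = 0
  BR : ⁅B, R⁆ = 0
  BS : ⁅B, S⁆ = 0
  BT : ⁅B, T⁆ = 0
  CR : ⁅C, R⁆ = 0
  CS : ⁅C, S⁆ = 0
  CT : ⁅C, T⁆ = 0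

theorem exists_smul_add_of_mem_span_six {𝕜 M : Type*} [Ring 𝕜] [AddCommGroup M] [Module 𝕜 M]
    {A B C R S T v : M} (hv : v ∈ Submodule.span 𝕜 ({A, B, C, R, S, T} : Set M)) :
    ∃ a b c r s t : 𝕜, v = a • A + b • B + c • C + r • R + s • S + t • T := by
  simp only [Submodule.mem_span_insert, Submodule.mem_span_singleton] at hv
  obtain ⟨a, _, ⟨b, _, ⟨c, _, ⟨r, _, ⟨s, _, ⟨t, rfl⟩, rfl⟩, rfl⟩, rfl⟩, rfl⟩, rfl⟩ := hv
  exact ⟨a, b, c, r, s, t, by abel⟩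

theorem LinearIndependent.exists_linearMap_six {𝕜 M : Type*} [Field 𝕜] [AddCommGroup M]
    [Module 𝕜 M] {A B C R S T : M} (h : LinearIndependent 𝕜 ![A, B, C, R, S, T]) :
    ∃ f : M →ₗ[𝕜] (Fin 6 → 𝕜), f A = ![1, 0, 0, 0, 0, 0] ∧ f B = ![0, 1, 0, 0, 0, 0] ∧
      f C = ![0, 0, 1, 0, 0, 0] ∧ f R = ![0, 0, 0, 1, 0, 0] ∧ f S = ![0, 0, 0, 0, 1, 0] ∧
      f T = ![0, 0, 0, 0, 0, 1] := by
  obtain ⟨f, hf⟩ := LinearMap.exists_leftInverse_of_injective _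
    (LinearMap.ker_eq_bot.mpr h.fintypeLinearCombination_injective)
  refine ⟨f, ?_, ?_, ?_, ?_, ?_, ?_⟩
  · simpa [Fintype.linearCombination_apply, Fin.sum_univ_six] using
      LinearMap.congr_fun hf ![1, 0, 0, 0, 0, 0]
  · simpa [Fintype.linearCombination_apply, Fin.sum_univ_six] using
      LinearMap.congr_fun hf ![0, 1, 0, 0, 0, 0]
  · simpa [Fintype.linearCombination_apply, Fin.sum_univ_six] using
      LinearMap.congr_fun hf ![0, 0, 1, 0, 0, 0]
  · simpa [Fintype.linearCombination_apply, Fin.sum_univ_six] using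
      LinearMap.congr_fun hf ![0, 0, 0, 1, 0, 0]
  · simpa [Fintype.linearCombination_apply, Fin.sum_univ_six] using
      LinearMap.congr_fun hf ![0, 0, 0, 0, 1, 0]
  · simpa [Fintype.linearCombination_apply, Fin.sum_univ_six] using
      LinearMap.congr_fun hf ![0, 0, 0, 0, 0, 1]

namespace IsSu2Sl2Sextuple

variable {L : Type*} [LieRing L] [LieAlgebra ℝ L] {A B C R S T : L}

theorem lie_smul_add (h : IsSu2Sl2Sextuple A B C R S T) (a b c r s t : ℝ) :
    ⁅A, a • A + b • B + c • C + r • R + s • S + t • T⁆ = (-2 * c) • B + (2 * b) • C ∧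
    ⁅B, a • A + b • B + c • C + r • R + s • S + t • T⁆ = (2 * c) • A + (-2 * a) • C ∧
    ⁅C, a • A + b • B + c • C + r • R + s • S + t • T⁆ = (-2 * b) • A + (2 * a) • B ∧
    ⁅R, a • A + b • B + c • C + r • R + s • S + t • T⁆ = (-2 * t) • S + (2 * s) • T ∧
    ⁅S, a • A + b • B + c • C + r • R + s • S + t • T⁆ = (-2 * t) • R + (-2 * r) • T ∧
    ⁅T, a • A + b • B + c • C + r • R + s • S + t • T⁆ = (2 * s) • R + (2 * r) • S := by
  simp only [lie_add, lie_smul, lie_self, h.AB, h.BC, h.CA, h.RS, h.ST, h.TR, h.AR, h.AS, h.AT,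
    h.BR, h.BS, h.BT, h.CR, h.CS, h.CT, ← lie_skew A C, ← lie_skew B A, ← lie_skew C B,
    ← lie_skew R T, ← lie_skew S R, ← lie_skew T S, ← lie_skew R A, ← lie_skew S A,
    ← lie_skew T A, ← lie_skew R B, ← lie_skew S B, ← lie_skew T B, ← lie_skew R C,
    ← lie_skew S C, ← lie_skew T C]
  refine ⟨?_, ?_, ?_, ?_, ?_, ?_⟩ <;> module

/-- The six vectors span a subalgebra with trivial centre. -/
theorem eq_zero_of_forall_lie_eq_zero (h : IsSu2Sl2Sextuple A B C R S T)
    (hli : LinearIndependent ℝ ![A, B, C, R, S, T]) {u : L}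
    (hu : u ∈ Submodule.span ℝ ({A, B, C, R, S, T} : Set L)) (hA : ⁅A, u⁆ = 0) (hB : ⁅B, u⁆ = 0)
    (hR : ⁅R, u⁆ = 0) (hS : ⁅S, u⁆ = 0) : u = 0 := by
  obtain ⟨f, fA, fB, fC, fR, fS, fT⟩ := hli.exists_linearMap_six
  obtain ⟨a, b, c, r, s, t, rfl⟩ := exists_smul_add_of_mem_span_six hu
  obtain ⟨eA, eB, -, eR, eS, -⟩ := h.lie_smul_add a b c r s t
  replace hA := congrArg f (eA.symm.trans hA)
  replace hB := congrArg f (eB.symm.trans hB)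
  replace hR := congrArg f (eR.symm.trans hR)
  replace hS := congrArg f (eS.symm.trans hS)
  simp [fA, fB, fC, fR, fS, fT] at hA hB hR hS
  simp [hA, hB, hR, hS]

/-- Every derivation `⁅·, Z⁆` preserving the span of the six vectors is inner. -/
theorem exists_lie_eq (h : IsSu2Sl2Sextuple A B C R S T)
    (hli : LinearIndependent ℝ ![A, B, C, R, S, T]) {Z : L}
    (hA : ⁅A, Z⁆ ∈ Submodule.span ℝ ({A, B, C, R, S, T} : Set L))
    (hB : ⁅B, Z⁆ ∈ Submodule.span ℝ ({A, B, C, R, S, T} : Set L))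
    (hC : ⁅C, Z⁆ ∈ Submodule.span ℝ ({A, B, C, R, S, T} : Set L))
    (hR : ⁅R, Z⁆ ∈ Submodule.span ℝ ({A, B, C, R, S, T} : Set L))
    (hS : ⁅S, Z⁆ ∈ Submodule.span ℝ ({A, B, C, R, S, T} : Set L))
    (hT : ⁅T, Z⁆ ∈ Submodule.span ℝ ({A, B, C, R, S, T} : Set L)) :
    ∃ b₁ c₁ c₂ s₄ t₄ t₅ : ℝ,
      ⁅A, Z⁆ = -(b₁ • B) - c₁ • C ∧ ⁅B, Z⁆ = b₁ • A - c₂ • C ∧ ⁅C, Z⁆ = c₁ • A + c₂ • B ∧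
      ⁅R, Z⁆ = s₄ • S + t₄ • T ∧ ⁅S, Z⁆ = s₄ • R - t₅ • T ∧ ⁅T, Z⁆ = t₄ • R + t₅ • S := by
  obtain ⟨f, fA, fB, fC, fR, fS, fT⟩ := hli.exists_linearMap_six
  obtain ⟨a₁, a₂, a₃, a₄, a₅, a₆, eA⟩ := exists_smul_add_of_mem_span_six hA
  obtain ⟨b₁, b₂, b₃, b₄, b₅, b₆, eB⟩ := exists_smul_add_of_mem_span_six hB
  obtain ⟨c₁, c₂, c₃, c₄, c₅, c₆, eC⟩ := exists_smul_add_of_mem_span_six hC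
  obtain ⟨r₁, r₂, r₃, r₄, r₅, r₆, eR⟩ := exists_smul_add_of_mem_span_six hR
  obtain ⟨s₁, s₂, s₃, s₄, s₅, s₆, eS⟩ := exists_smul_add_of_mem_span_six hS
  obtain ⟨t₁, t₂, t₃, t₄, t₅, t₆, eT⟩ := exists_smul_add_of_mem_span_six hT
  have brA a b c r s t := (h.lie_smul_add a b c r s t).1
  have brB a b c r s t := (h.lie_smul_add a b c r s t).2.1
  have brC a b c r s t := (h.lie_smul_add a b c r s t).2.2.1
  have brR a b c r s t := (h.lie_smul_add a b c r s t).2.2.2.1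
  have brS a b c r s t := (h.lie_smul_add a b c r s t).2.2.2.2.1
  have brT a b c r s t := (h.lie_smul_add a b c r s t).2.2.2.2.2
  have jAB := congrArg f (lie_lie A B Z)
  have jBC := congrArg f (lie_lie B C Z)
  have jCA := congrArg f (lie_lie C A Z)
  have jRS := congrArg f (lie_lie R S Z)
  have jST := congrArg f (lie_lie S T Z)
  have jTR := congrArg f (lie_lie T R Z)
  rw [h.AB, smul_lie, eA, eB, eC, brA, brB] at jAB
  rw [h.BC, smul_lie, eA, eB, eC, brB, brC] at jBC
  rw [h.CA, smul_lie, eA, eB, eC, brC, brA] at jCA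
  rw [h.RS, smul_lie, eR, eS, eT, brR, brS] at jRS
  rw [h.ST, neg_lie, smul_lie, eR, eS, eT, brS, brT] at jST
  rw [h.TR, smul_lie, eR, eS, eT, brT, brR] at jTR
  simp [fA, fB, fC, fR, fS, fT] at jAB jBC jCA jRS jST jTR
  refine ⟨b₁, c₁, c₂, s₄, t₄, t₅, ?_, ?_, ?_, ?_, ?_, ?_⟩
  · rw [eA]
    match_scalars <;> grind
  · rw [eB]
    match_scalars <;> grind
  · rw [eC]
    match_scalars <;> grind
  · rw [eR]
    match_scalars <;> grind
  · rw [eS]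
    match_scalars <;> grind
  · rw [eT]
    match_scalars <;> grind

end IsSu2Sl2Sextuple

theorem stmt_6 {L : Type*} [LieRing L] [LieAlgebra ℝ L]
    (A B C R S T X Y : L)
    (hindep : LinearIndependent ℝ ![A, B, C, R, S, T, X, Y])
    (hspan : Submodule.span ℝ ({A, B, C, R, S, T, X, Y} : Set L) = ⊤)
    (hAB : ⁅A, B⁆ = (2:ℝ) • C)
    (hCA : ⁅C, A⁆ = (2:ℝ) • B)
    (hBC : ⁅B, C⁆ = (2:ℝ) • A)
    (hRS : ⁅R, S⁆ = (2:ℝ) • T)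
    (hTR : ⁅T, R⁆ = (2:ℝ) • S)
    (hST : ⁅S, T⁆ = -((2:ℝ) • R))
    (hAR : ⁅A, R⁆ = 0)
    (hAS : ⁅A, S⁆ = 0)
    (hAT : ⁅A, T⁆ = 0)
    (hBR : ⁅B, R⁆ = 0)
    (hBS : ⁅B, S⁆ = 0)
    (hBT : ⁅B, T⁆ = 0)
    (hCR : ⁅C, R⁆ = 0)
    (hCS : ⁅C, S⁆ = 0)
    (hCT : ⁅C, T⁆ = 0)
    (mAX : ⁅A, X⁆ ∈ Submodule.span ℝ ({A, B, C, R, S, T} : Set L))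
    (mAY : ⁅A, Y⁆ ∈ Submodule.span ℝ ({A, B, C, R, S, T} : Set L))
    (mBX : ⁅B, X⁆ ∈ Submodule.span ℝ ({A, B, C, R, S, T} : Set L))
    (mBY : ⁅B, Y⁆ ∈ Submodule.span ℝ ({A, B, C, R, S, T} : Set L))
    (mCX : ⁅C, X⁆ ∈ Submodule.span ℝ ({A, B, C, R, S, T} : Set L))
    (mCY : ⁅C, Y⁆ ∈ Submodule.span ℝ ({A, B, C, R, S, T} : Set L))
    (mRX : ⁅R, X⁆ ∈ Submodule.span ℝ ({A, B, C, R, S, T} : Set L))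
    (mRY : ⁅R, Y⁆ ∈ Submodule.span ℝ ({A, B, C, R, S, T} : Set L))
    (mSX : ⁅S, X⁆ ∈ Submodule.span ℝ ({A, B, C, R, S, T} : Set L))
    (mSY : ⁅S, Y⁆ ∈ Submodule.span ℝ ({A, B, C, R, S, T} : Set L))
    (mTX : ⁅T, X⁆ ∈ Submodule.span ℝ ({A, B, C, R, S, T} : Set L))
    (mTY : ⁅T, Y⁆ ∈ Submodule.span ℝ ({A, B, C, R, S, T} : Set L))
    (mXY : ⁅X, Y⁆ ∈ Submodule.span ℝ ({X, A, B, C, R, S, T} : Set L)) :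
    ∃ b11 b21 c11 c12 c21 c22 s14 s24 t14 t15 t24 t25 ρ : ℝ,
      ⁅A, X⁆ = -(b11 • B) - c11 • C ∧
      ⁅A, Y⁆ = -(b21 • B) - c21 • C ∧
      ⁅B, X⁆ = b11 • A - c12 • C ∧
      ⁅B, Y⁆ = b21 • A - c22 • C ∧
      ⁅C, X⁆ = c11 • A + c12 • B ∧
      ⁅C, Y⁆ = c21 • A + c22 • B ∧
      ⁅R, X⁆ = s14 • S + t14 • T ∧
      ⁅R, Y⁆ = s24 • S + t24 • T ∧
      ⁅S, X⁆ = s14 • R - t15 • T ∧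
      ⁅S, Y⁆ = s24 • R - t25 • T ∧
      ⁅T, X⁆ = t14 • R + t15 • S ∧
      ⁅T, Y⁆ = t24 • R + t25 • S ∧
      ⁅X, Y⁆ = ρ • X + ((-ρ*c12 + b11*c21 - b21*c11)/2) • A + ((ρ*c11 + b11*c22 - b21*c12)/2) • B +
      ((-ρ*b11 + c11*c22 - c12*c21)/2) • C + ((-ρ*t15 - s14*t24 + s24*t14)/2) • R +
      ((-ρ*t14 - s14*t25 + s24*t15)/2) • S + ((ρ*s14 - t14*t25 + t15*t24)/2) • T := by
  have h : IsSu2Sl2Sextuple A B C R S T :=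
    ⟨hAB, hCA, hBC, hRS, hTR, hST, hAR, hAS, hAT, hBR, hBS, hBT, hCR, hCS, hCT⟩
  have hli : LinearIndependent ℝ ![A, B, C, R, S, T] := by
    have hcomp : ![A, B, C, R, S, T] = ![A, B, C, R, S, T, X, Y] ∘ Fin.castAdd 2 := by
      ext i
      fin_cases i <;> rfl
    rw [hcomp]
    exact hindep.comp _ (Fin.castAdd_injective 6 2)
  obtain ⟨b11, c11, c12, s14, t14, t15, AX, BX, CX, RX, SX, TX⟩ :=
    h.exists_lie_eq hli mAX mBX mCX mRX mSX mTX
  obtain ⟨b21, c21, c22, s24, t24, t25, AY, BY, CY, RY, SY, TY⟩ :=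
    h.exists_lie_eq hli mAY mBY mCY mRY mSY mTY
  obtain ⟨ρ, v, hv, hXY⟩ := Submodule.mem_span_insert.mp mXY
  refine ⟨b11, b21, c11, c12, c21, c22, s14, s24, t14, t15, t24, t25, ρ,
    AX, AY, BX, BY, CX, CY, RX, RY, SX, SY, TX, TY, ?_⟩
  rw [hXY, ← sub_eq_zero]
  set θ := ((-ρ*c12 + b11*c21 - b21*c11)/2) • A + ((ρ*c11 + b11*c22 - b21*c12)/2) • B +
      ((-ρ*b11 + c11*c22 - c12*c21)/2) • C + ((-ρ*t15 - s14*t24 + s24*t14)/2) • R +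
      ((-ρ*t14 - s14*t25 + s24*t15)/2) • S + ((ρ*s14 - t14*t25 + t15*t24)/2) • T with hθ
  have hθ_mem : θ ∈ Submodule.span ℝ ({A, B, C, R, S, T} : Set L) := by
    have hsub := Submodule.subset_span (R := ℝ) (s := ({A, B, C, R, S, T} : Set L))
    refine add_mem (add_mem (add_mem (add_mem (add_mem ?_ ?_) ?_) ?_) ?_) ?_ <;>
      exact Submodule.smul_mem _ _ (hsub (by simp))
  have hv_eq : v = ⁅X, Y⁆ - ρ • X := by rw [hXY]; abel
  obtain ⟨θA, θB, -, θR, θS, -⟩ := h.lie_smul_add ((-ρ*c12 + b11*c21 - b21*c11)/2)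
    ((ρ*c11 + b11*c22 - b21*c12)/2) ((-ρ*b11 + c11*c22 - c12*c21)/2)
    ((-ρ*t15 - s14*t24 + s24*t14)/2) ((-ρ*t14 - s14*t25 + s24*t15)/2)
    ((ρ*s14 - t14*t25 + t15*t24)/2)
  have hvθ : v - θ = 0 := by
    apply h.eq_zero_of_forall_lie_eq_zero hli (sub_mem hv hθ_mem)
    all_goals
      rw [lie_sub, hv_eq, lie_sub, leibniz_lie, lie_smul, ← lie_skew X]
      first | rw [AX, AY, hθ, θA] | rw [BX, BY, hθ, θB] | rw [RX, RY, hθ, θR] |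
        rw [SX, SY, hθ, θS]
      simp only [add_lie, sub_lie, neg_lie, smul_lie, AX, AY, BX, BY, CX, CY, RX, RY, SX, SY,
        TX, TY]
      module
  rw [← hvθ, hθ]
  abel
end

section
/- For every choice of real parameters b11, b21, c11, c12, c21, c22, s14, s24, t14, t15, t24, t25, ρ, the antisymmetric bilinear bracket on the 8-dimensional real vector space with basis {A,B,C,R,S,T,X,Y} defined by [A,B]=2C, [C,A]=2B, [B,C]=2A, [R,S]=2T, [T,R]=2S, [S,T]=−2R together with [A,X]=−b11·B−c11·C, [A,Y]=−b21·B−c21·C, [B,X]=b11·A−c12·C, [B,Y]=b21·A−c22·C, [C,X]=c11·A+c12·B, [C,Y]=c21·A+c22·B, [R,X]=s14·S+t14·T, [R,Y]=s24·S+t24·T, [S,X]=s14·R−t15·T, [S,Y]=s24·R−t25·T, [T,X]=t14·R+t15·S, [T,Y]=t24·R+t25·S, [X,Y]=ρ·X+θ₁·A+θ₂·B+θ₃·C+θ₄·R+θ₅·S+θ₆·T satisfies the Jacobi identity, and hence defines an 8-dimensional real Lie algebra containing span{A,B,C,R,S,T} ≅ su(2)⊕sl(2,ℝ) as a Lie subalgebra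 of codimension two. -/
/-- An 8-dimensional real Lie algebra realising the given bracket relations:
the Jacobi identity holds (it is a `LieRing`), the eight listed elements form a basis,
and the span of `A, B, C, R, S, T` is a Lie subalgebra of codimension two. -/
structure SU2xSL2Family (b11 b21 c11 c12 c21 c22 s14 s24 t14 t15 t24 t25 ρ : ℝ) where
  L : Type
  [lieRing : LieRing L]
  [lieAlgebra : LieAlgebra ℝ L]
  A : L
  B : L
  C : L
  R : L
  S : L
  T : L
  X : L
  Y : L
  indep : LinearIndependent ℝ ![A, B, C, R, S, T, X, Y]
  span_top : Submodule.span ℝ ({A, B, C, R, S, T, X, Y} : Set L) = ⊤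
  codim_two : Module.finrank ℝ (L ⧸ Submodule.span ℝ ({A, B, C, R, S, T} : Set L)) = 2
  hAB : ⁅A, B⁆ = (2:ℝ) • C
  hCA : ⁅C, A⁆ = (2:ℝ) • B
  hBC : ⁅B, C⁆ = (2:ℝ) • A
  hRS : ⁅R, S⁆ = (2:ℝ) • T
  hTR : ⁅T, R⁆ = (2:ℝ) • S
  hST : ⁅S, T⁆ = -((2:ℝ) • R)
  hAR : ⁅A, R⁆ = 0
  hAS : ⁅A, S⁆ = 0
  hAT : ⁅A, T⁆ = 0
  hBR : ⁅B, R⁆ = 0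
  hBS : ⁅B, S⁆ = 0
  hBT : ⁅B, T⁆ = 0
  hCR : ⁅C, R⁆ = 0
  hCS : ⁅C, S⁆ = 0
  hCT : ⁅C, T⁆ = 0
  hAX : ⁅A, X⁆ = -(b11 • B) - c11 • C
  hAY : ⁅A, Y⁆ = -(b21 • B) - c21 • C
  hBX : ⁅B, X⁆ = b11 • A - c12 • C
  hBY : ⁅B, Y⁆ = b21 • A - c22 • C
  hCX : ⁅C, X⁆ = c11 • A + c12 • B
  hCY : ⁅C, Y⁆ = c21 • A + c22 • B
  hRX : ⁅R, X⁆ = s14 • S + t14 • T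
  hRY : ⁅R, Y⁆ = s24 • S + t24 • T
  hSX : ⁅S, X⁆ = s14 • R - t15 • T
  hSY : ⁅S, Y⁆ = s24 • R - t25 • T
  hTX : ⁅T, X⁆ = t14 • R + t15 • S
  hTY : ⁅T, Y⁆ = t24 • R + t25 • S
  hXY : ⁅X, Y⁆ = ρ • X + ((-ρ*c12 + b11*c21 - b21*c11)/2) • A + ((ρ*c11 + b11*c22 - b21*c12)/2) • B +
      ((-ρ*b11 + c11*c22 - c12*c21)/2) • C + ((-ρ*t15 - s14*t24 + s24*t14)/2) • R +
      ((-ρ*t14 - s14*t25 + s24*t15)/2) • S + ((ρ*s14 - t14*t25 + t15*t24)/2) • T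

/-- The coordinate space of the Lie algebra `su(2) ⊕ sl(2, ℝ) ⊕ 𝔯`, where `𝔯` is the
two-dimensional Lie algebra with basis `z, w` and bracket `⁅z, w⁆ = ρ • z`. -/
def SU2SL2Sum (_ρ : ℝ) : Type := Fin 8 → ℝ

namespace SU2SL2Sum

variable {ρ : ℝ}

noncomputable instance : AddCommGroup (SU2SL2Sum ρ) := inferInstanceAs (AddCommGroup (Fin 8 → ℝ))

noncomputable instance : Module ℝ (SU2SL2Sum ρ) := inferInstanceAs (Module ℝ (Fin 8 → ℝ))

instance : Module.Finite ℝ (SU2SL2Sum ρ) := inferInstanceAs (Module.Finite ℝ (Fin 8 → ℝ))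

theorem finrank_eq : Module.finrank ℝ (SU2SL2Sum ρ) = 8 :=
  Module.finrank_fin_fun ℝ

/-- The element with the given coordinates. -/
def mk (v : Fin 8 → ℝ) : SU2SL2Sum ρ := v

/-- The `i`-th coordinate. -/
def coord (u : SU2SL2Sum ρ) (i : Fin 8) : ℝ := u i

@[ext] theorem ext {u v : SU2SL2Sum ρ} (h : ∀ i, u.coord i = v.coord i) : u = v := funext h

@[simp] theorem coord_mk (v : Fin 8 → ℝ) (i : Fin 8) : (mk v : SU2SL2Sum ρ).coord i = v i := rfl

@[simp] theorem coord_zero (i : Fin 8) : (0 : SU2SL2Sum ρ).coord i = 0 := rfl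

@[simp] theorem coord_add (u v : SU2SL2Sum ρ) (i : Fin 8) :
    (u + v).coord i = u.coord i + v.coord i := rfl

@[simp] theorem coord_neg (u : SU2SL2Sum ρ) (i : Fin 8) : (-u).coord i = -u.coord i := rfl

@[simp] theorem coord_sub (u v : SU2SL2Sum ρ) (i : Fin 8) :
    (u - v).coord i = u.coord i - v.coord i := rfl

@[simp] theorem coord_smul (r : ℝ) (u : SU2SL2Sum ρ) (i : Fin 8) :
    (r • u).coord i = r * u.coord i := rfl

noncomputable instance : Bracket (SU2SL2Sum ρ) (SU2SL2Sum ρ) where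
  bracket u v := mk
    ![2 * (u.coord 1 * v.coord 2 - u.coord 2 * v.coord 1),
      2 * (u.coord 2 * v.coord 0 - u.coord 0 * v.coord 2),
      2 * (u.coord 0 * v.coord 1 - u.coord 1 * v.coord 0),
      -2 * (u.coord 4 * v.coord 5 - u.coord 5 * v.coord 4),
      2 * (u.coord 5 * v.coord 3 - u.coord 3 * v.coord 5),
      2 * (u.coord 3 * v.coord 4 - u.coord 4 * v.coord 3),
      ρ * (u.coord 6 * v.coord 7 - u.coord 7 * v.coord 6),
      0]

theorem bracket_def (u v : SU2SL2Sum ρ) : ⁅u, v⁆ = mk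
    ![2 * (u.coord 1 * v.coord 2 - u.coord 2 * v.coord 1),
      2 * (u.coord 2 * v.coord 0 - u.coord 0 * v.coord 2),
      2 * (u.coord 0 * v.coord 1 - u.coord 1 * v.coord 0),
      -2 * (u.coord 4 * v.coord 5 - u.coord 5 * v.coord 4),
      2 * (u.coord 5 * v.coord 3 - u.coord 3 * v.coord 5),
      2 * (u.coord 3 * v.coord 4 - u.coord 4 * v.coord 3),
      ρ * (u.coord 6 * v.coord 7 - u.coord 7 * v.coord 6),
      0] := rfl

noncomputable instance : LieRing (SU2SL2Sum ρ) where
  add_lie u v w := by ext i; fin_cases i <;> simp [bracket_def] <;> ring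
  lie_add u v w := by ext i; fin_cases i <;> simp [bracket_def] <;> ring
  lie_self u := by ext i; fin_cases i <;> simp [bracket_def, mul_comm]
  leibniz_lie u v w := by ext i; fin_cases i <;> simp [bracket_def] <;> ring

noncomputable instance : LieAlgebra ℝ (SU2SL2Sum ρ) where
  lie_smul r u v := by ext i; fin_cases i <;> simp [bracket_def] <;> ring

/-- The standard basis of `su(2) ⊕ sl(2, ℝ)`, followed by arbitrary lifts of the standard basis
of the quotient by `su(2) ⊕ sl(2, ℝ)`, is linearly independent. -/
theorem linearIndependent_lifts (x y : Fin 6 → ℝ) :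
    LinearIndependent ℝ
      ![(mk ![1, 0, 0, 0, 0, 0, 0, 0] : SU2SL2Sum ρ), mk ![0, 1, 0, 0, 0, 0, 0, 0],
        mk ![0, 0, 1, 0, 0, 0, 0, 0], mk ![0, 0, 0, 1, 0, 0, 0, 0],
        mk ![0, 0, 0, 0, 1, 0, 0, 0], mk ![0, 0, 0, 0, 0, 1, 0, 0],
        mk ![x 0, x 1, x 2, x 3, x 4, x 5, 1, 0], mk ![y 0, y 1, y 2, y 3, y 4, y 5, 0, 1]] := by
  rw [Fintype.linearIndependent_iff]
  intro g hg
  have hcoord (i : Fin 8) := congrArg (fun u : SU2SL2Sum ρ => u.coord i) hg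
  have h6 : g 6 = 0 := by simpa [Fin.sum_univ_eight] using hcoord 6
  have h7 : g 7 = 0 := by simpa [Fin.sum_univ_eight] using hcoord 7
  intro i
  fin_cases i
  · simpa [Fin.sum_univ_eight, h6, h7] using hcoord 0
  · simpa [Fin.sum_univ_eight, h6, h7] using hcoord 1
  · simpa [Fin.sum_univ_eight, h6, h7] using hcoord 2
  · simpa [Fin.sum_univ_eight, h6, h7] using hcoord 3
  · simpa [Fin.sum_univ_eight, h6, h7] using hcoord 4
  · simpa [Fin.sum_univ_eight, h6, h7] using hcoord 5
  · exact h6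
  · exact h7

end SU2SL2Sum

section EightVectors

variable {K V : Type*} [Field K] [AddCommGroup V] [Module K V]
  {a b c r s t x y : V}

theorem span_eq_top_of_linearIndependent_eight_s7
    (h : LinearIndependent K ![a, b, c, r, s, t, x, y]) (hV : Module.finrank K V = 8) :
    Submodule.span K {a, b, c, r, s, t, x, y} = ⊤ := by
  rw [← h.span_eq_top_of_card_eq_finrank (by simp [hV])]
  simp only [Matrix.range_cons, Matrix.range_empty, Set.union_empty, Set.singleton_union]

theorem finrank_quotient_span_of_linearIndependent_eight_s7 [Module.Finite K V]
    (h : LinearIndependent K ![a, b, c, r, s, t, x, y]) (hV : Module.finrank K V = 8) :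
    Module.finrank K (V ⧸ Submodule.span K {a, b, c, r, s, t}) = 2 := by
  have h6 : LinearIndependent K ![a, b, c, r, s, t] := by
    convert h.comp (Fin.castLE (show 6 ≤ 8 by decide)) (Fin.castLE_injective _) using 1
    funext i
    fin_cases i <;> rfl
  have hrange : Set.range ![a, b, c, r, s, t] = {a, b, c, r, s, t} := by
    simp only [Matrix.range_cons, Matrix.range_empty, Set.union_empty, Set.singleton_union]
  have hspan := finrank_span_eq_card h6
  rw [hrange, Fintype.card_fin] at hspan
  have hsum := (Submodule.span K {a, b, c, r, s, t}).finrank_quotient_add_finrank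
  omega

end EightVectors

theorem stmt_7 (b11 b21 c11 c12 c21 c22 s14 s24 t14 t15 t24 t25 ρ : ℝ) :
    Nonempty (SU2xSL2Family b11 b21 c11 c12 c21 c22 s14 s24 t14 t15 t24 t25 ρ) := by
  have hli := SU2SL2Sum.linearIndependent_lifts (ρ := ρ)
    ![c12 / 2, -c11 / 2, b11 / 2, t15 / 2, t14 / 2, -s14 / 2]
    ![c22 / 2, -c21 / 2, b21 / 2, t25 / 2, t24 / 2, -s24 / 2]
  refine ⟨{
    L := SU2SL2Sum ρ
    A := SU2SL2Sum.mk ![1, 0, 0, 0, 0, 0, 0, 0]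
    B := SU2SL2Sum.mk ![0, 1, 0, 0, 0, 0, 0, 0]
    C := SU2SL2Sum.mk ![0, 0, 1, 0, 0, 0, 0, 0]
    R := SU2SL2Sum.mk ![0, 0, 0, 1, 0, 0, 0, 0]
    S := SU2SL2Sum.mk ![0, 0, 0, 0, 1, 0, 0, 0]
    T := SU2SL2Sum.mk ![0, 0, 0, 0, 0, 1, 0, 0]
    X := SU2SL2Sum.mk ![c12 / 2, -c11 / 2, b11 / 2, t15 / 2, t14 / 2, -s14 / 2, 1, 0]
    Y := SU2SL2Sum.mk ![c22 / 2, -c21 / 2, b21 / 2, t25 / 2, t24 / 2, -s24 / 2, 0, 1]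
    indep := hli
    span_top := span_eq_top_of_linearIndependent_eight_s7 hli SU2SL2Sum.finrank_eq
    codim_two := finrank_quotient_span_of_linearIndependent_eight_s7 hli SU2SL2Sum.finrank_eq
    hAB := ?_
    hCA := ?_
    hBC := ?_
    hRS := ?_
    hTR := ?_
    hST := ?_
    hAR := ?_
    hAS := ?_
    hAT := ?_
    hBR := ?_
    hBS := ?_
    hBT := ?_
    hCR := ?_
    hCS := ?_
    hCT := ?_
    hAX := ?_
    hAY := ?_
    hBX := ?_
    hBY := ?_
    hCX := ?_
    hCY := ?_
    hRX := ?_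
    hRY := ?_
    hSX := ?_
    hSY := ?_
    hTX := ?_
    hTY := ?_
    hXY := ?_}⟩
  all_goals
    ext i
    fin_cases i <;> simp [SU2SL2Sum.bracket_def] <;> ring
end

section
/- For every choice of real parameters b11, b21, c11, c12, c21, c22, x1, x2, y1, ρ, θ₄, the antisymmetric bilinear bracket on the 6-dimensional real vector space with basis {A,B,C,T,X,Y} defined by [A,B]=2C, [C,A]=2B, [B,C]=2A, [T,A]=[T,B]=[T,C]=0, [A,X]=−b11·B−c11·C, [A,Y]=−b21·B−c21·C, [B,X]=b11·A−c12·C, [B,Y]=b21·A−c22·C, [C,X]=c11·A+c12·B, [C,Y]=c21·A+c22·B, [T,X]=x1·X+y1·Y+((−c12·x1−c22·y1)·A+(c11·x1+c21·y1)·B+(−b11·x1−b21·y1)·C)/2, [T,Y]=x2·X−x1·Y+((−c12·x2+c22·x1)·A+(c11·x2−c21·x1)·B+(−b11·x2+b21·x1)·C)/2−ρ·T, [X,Y]=ρ·X+θ₁·A+θ₂·B+θ₃·C+θ₄·T satisfies the Jacobi identity, and hence defines a 6-dimensional real Lie algebra containing span{A,B,C,T} ≅ su(2)⊕so(2) as a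 Lie subalgebra of codimension two. -/
/-- A 6-dimensional real Lie algebra realising the given bracket relations:
the Jacobi identity holds (it is a `LieRing`), the six listed elements form a basis,
and the span of `A, B, C, T` is a Lie subalgebra of codimension two. -/
structure SU2xSO2Family (b11 b21 c11 c12 c21 c22 x1 x2 y1 ρ θ4 : ℝ) where
  L : Type
  [lieRing : LieRing L]
  [lieAlgebra : LieAlgebra ℝ L]
  A : L
  B : L
  C : L
  T : L
  X : L
  Y : L
  indep : LinearIndependent ℝ ![A, B, C, T, X, Y]
  span_top : Submodule.span ℝ ({A, B, C, T, X, Y} : Set L) = ⊤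
  codim_two : Module.finrank ℝ (L ⧸ Submodule.span ℝ ({A, B, C, T} : Set L)) = 2
  hAB : ⁅A, B⁆ = (2:ℝ) • C
  hCA : ⁅C, A⁆ = (2:ℝ) • B
  hBC : ⁅B, C⁆ = (2:ℝ) • A
  hTA : ⁅T, A⁆ = 0
  hTB : ⁅T, B⁆ = 0
  hTC : ⁅T, C⁆ = 0
  hAX : ⁅A, X⁆ = -(b11 • B) - c11 • C
  hAY : ⁅A, Y⁆ = -(b21 • B) - c21 • C
  hBX : ⁅B, X⁆ = b11 • A - c12 • C
  hBY : ⁅B, Y⁆ = b21 • A - c22 • C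
  hCX : ⁅C, X⁆ = c11 • A + c12 • B
  hCY : ⁅C, Y⁆ = c21 • A + c22 • B
  hTX : ⁅T, X⁆ = x1 • X + y1 • Y + ((-c12*x1 - c22*y1)/2) • A +
      ((c11*x1 + c21*y1)/2) • B + ((-b11*x1 - b21*y1)/2) • C
  hTY : ⁅T, Y⁆ = x2 • X - x1 • Y + ((-c12*x2 + c22*x1)/2) • A +
      ((c11*x2 - c21*x1)/2) • B + ((-b11*x2 + b21*x1)/2) • C - ρ • T
  hXY : ⁅X, Y⁆ = ρ • X + ((-ρ*c12 + b11*c21 - b21*c11)/2) • A + ((ρ*c11 + b11*c22 - b21*c12)/2) • B +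
      ((-ρ*b11 + c11*c22 - c12*c21)/2) • C + θ4 • T

/-- The bracket on `ℝ³` with `[T, X] = x1 X + y1 Y`, `[T, Y] = x2 X - x1 Y - ρ T` and
`[X, Y] = ρ X + θ4 T`, in the coordinates `(T, X, Y)`. -/
def centralizerBracket (x1 x2 y1 ρ θ4 : ℝ) (u v : Fin 3 → ℝ) : Fin 3 → ℝ :=
  ![-ρ * (u 0 * v 2 - u 2 * v 0) + θ4 * (u 1 * v 2 - u 2 * v 1),
    x1 * (u 0 * v 1 - u 1 * v 0) + x2 * (u 0 * v 2 - u 2 * v 0) + ρ * (u 1 * v 2 - u 2 * v 1),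
    y1 * (u 0 * v 1 - u 1 * v 0) - x1 * (u 0 * v 2 - u 2 * v 0)]

/-- The Lie ring on `ℝ³` given by `centralizerBracket`. -/
abbrev centralizerLieRing (x1 x2 y1 ρ θ4 : ℝ) : LieRing (Fin 3 → ℝ) where
  bracket := centralizerBracket x1 x2 y1 ρ θ4
  add_lie u v w := by
    ext i; fin_cases i <;> simp [centralizerBracket] <;> ring
  lie_add u v w := by
    ext i; fin_cases i <;> simp [centralizerBracket] <;> ring
  lie_self u := by
    ext i; fin_cases i <;> simp [centralizerBracket] <;> ring
  leibniz_lie u v w := by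
    ext i; fin_cases i <;> simp [centralizerBracket] <;> ring

/-- The Lie algebra on `ℝ³` given by `centralizerBracket`. -/
abbrev centralizerLieAlgebra (x1 x2 y1 ρ θ4 : ℝ) :
    letI := centralizerLieRing x1 x2 y1 ρ θ4
    LieAlgebra ℝ (Fin 3 → ℝ) :=
  letI := centralizerLieRing x1 x2 y1 ρ θ4
  { lie_smul := fun t u v => by
      change centralizerBracket _ _ _ _ _ _ _ = t • centralizerBracket _ _ _ _ _ _ _
      ext i; fin_cases i <;> simp [centralizerBracket] <;> ring }

/-- The cross product makes `ℝ³` a real Lie algebra. -/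
abbrev crossLieAlgebra :
    letI : LieRing (Fin 3 → ℝ) := Cross.lieRing
    LieAlgebra ℝ (Fin 3 → ℝ) :=
  letI : LieRing (Fin 3 → ℝ) := Cross.lieRing
  { lie_smul := fun t u v => (crossProduct u).map_smul t v }

/-- The product of `ℝ³` with the cross product and `ℝ³` with `centralizerBracket`. -/
abbrev crossProdCentralizerLieRing (x1 x2 y1 ρ θ4 : ℝ) :
    LieRing ((Fin 3 → ℝ) × (Fin 3 → ℝ)) :=
  @LieAlgebra.Prod.instLieRing _ _ Cross.lieRing (centralizerLieRing x1 x2 y1 ρ θ4)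

/-- The Lie algebra structure on the product of `ℝ³` with the cross product and `ℝ³` with
`centralizerBracket`. -/
abbrev crossProdCentralizerLieAlgebra (x1 x2 y1 ρ θ4 : ℝ) :
    letI := crossProdCentralizerLieRing x1 x2 y1 ρ θ4
    LieAlgebra ℝ ((Fin 3 → ℝ) × (Fin 3 → ℝ)) :=
  @LieAlgebra.Prod.instLieAlgebra ℝ _ _ _ Cross.lieRing crossLieAlgebra
    (centralizerLieRing x1 x2 y1 ρ θ4) (centralizerLieAlgebra x1 x2 y1 ρ θ4)

theorem crossProdCentralizer_lie (x1 x2 y1 ρ θ4 : ℝ) (p q : (Fin 3 → ℝ) × (Fin 3 → ℝ)) :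
    letI := crossProdCentralizerLieRing x1 x2 y1 ρ θ4
    ⁅p, q⁆ = (crossProduct p.1 q.1, centralizerBracket x1 x2 y1 ρ θ4 p.2 q.2) :=
  rfl

/-- Quotienting by the span of four of six independent vectors leaves dimension two. -/
theorem finrank_quotient_span_four_eq_two {V : Type*} [AddCommGroup V] [Module ℝ V]
    [FiniteDimensional ℝ V] (hV : Module.finrank ℝ V = 6) {a b c t x y : V}
    (h : LinearIndependent ℝ ![a, b, c, t, x, y]) :
    Module.finrank ℝ (V ⧸ Submodule.span ℝ ({a, b, c, t} : Set V)) = 2 := by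
  have h4 : LinearIndependent ℝ ![a, b, c, t] := by
    have h46 : 4 ≤ 6 := by simp
    convert h.comp (Fin.castLE h46) (Fin.castLE_injective h46) using 1
    ext i; fin_cases i <;> rfl
  have hs := finrank_span_eq_card h4
  have hr : Set.range ![a, b, c, t] = {a, b, c, t} := by
    simp only [Matrix.range_cons, Matrix.range_empty, Set.union_empty, Set.singleton_union]
  rw [hr, Fintype.card_fin] at hs
  have hq := Submodule.finrank_quotient_add_finrank (Submodule.span ℝ ({a, b, c, t} : Set V))
  omega

theorem span_six_eq_top {V : Type*} [AddCommGroup V] [Module ℝ V]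
    [FiniteDimensional ℝ V] (hV : Module.finrank ℝ V = 6) {a b c t x y : V}
    (h : LinearIndependent ℝ ![a, b, c, t, x, y]) :
    Submodule.span ℝ ({a, b, c, t, x, y} : Set V) = ⊤ := by
  rw [← h.span_eq_top_of_card_eq_finrank' (by simp [hV])]
  simp only [Matrix.range_cons, Matrix.range_empty, Set.union_empty, Set.singleton_union]

theorem linearIndependent_shifted_basis (u v : Fin 3 → ℝ) :
    LinearIndependent ℝ (![(![2, 0, 0], 0), (![0, 2, 0], 0), (![0, 0, 2], 0),
      (0, ![1, 0, 0]), (u, ![0, 1, 0]), (v, ![0, 0, 1])] :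
      Fin 6 → (Fin 3 → ℝ) × (Fin 3 → ℝ)) := by
  rw [Fintype.linearIndependent_iff]
  intro g hg
  have h1 := congrArg Prod.fst hg
  have h2 := congrArg Prod.snd hg
  simp only [Fin.sum_univ_succ] at h1 h2
  simp [funext_iff, Fin.forall_fin_succ] at h2
  obtain ⟨h3, h4, h5⟩ := h2
  simp [funext_iff, Fin.forall_fin_succ, h4, h5] at h1
  simp [Fin.forall_fin_succ, h1, h3, h4, h5]

theorem stmt_11 (b11 b21 c11 c12 c21 c22 x1 x2 y1 ρ θ4 : ℝ) :
    Nonempty (SU2xSO2Family b11 b21 c11 c12 c21 c22 x1 x2 y1 ρ θ4) := by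
  let := crossProdCentralizerLieRing x1 x2 y1 ρ θ4
  let := crossProdCentralizerLieAlgebra x1 x2 y1 ρ θ4
  have hV : Module.finrank ℝ ((Fin 3 → ℝ) × (Fin 3 → ℝ)) = 6 := by simp
  have hli := linearIndependent_shifted_basis ![c12, -c11, b11] ![c22, -c21, b21]
  refine ⟨{
    L := (Fin 3 → ℝ) × (Fin 3 → ℝ)
    A := (![2, 0, 0], 0)
    B := (![0, 2, 0], 0)
    C := (![0, 0, 2], 0)
    T := (0, ![1, 0, 0])
    X := (![c12, -c11, b11], ![0, 1, 0])
    Y := (![c22, -c21, b21], ![0, 0, 1])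
    indep := hli
    span_top := span_six_eq_top hV hli
    codim_two := finrank_quotient_span_four_eq_two hV hli
    hAB := ?_, hCA := ?_, hBC := ?_, hTA := ?_, hTB := ?_, hTC := ?_, hAX := ?_, hAY := ?_
    hBX := ?_, hBY := ?_, hCX := ?_, hCY := ?_, hTX := ?_, hTY := ?_, hXY := ?_ }⟩
  all_goals
    rw [crossProdCentralizer_lie]
    ext i <;> fin_cases i <;> simp [cross_apply, centralizerBracket] <;> ring
end

section
/- For every choice of real parameters b11, b21, c11, c12, c21, c22, x1, x2, y1, ρ, θ₄, the antisymmetric bilinear bracket on the 6-dimensional real vector space with basis {A,B,C,T,X,Y} defined by [A,B]=2C, [C,A]=2B, [B,C]=−2A, [T,A]=[T,B]=[T,C]=0, [A,X]=b11·B+c11·C, [A,Y]=b21·B+c21·C, [B,X]=b11·A−c12·C, [B,Y]=b21·A−c22·C, [C,X]=c11·A+c12·B, [C,Y]=c21·A+c22·B, [T,X]=x1·X+y1·Y+((−c12·x1−c22·y1)·A+(−c11·x1−c21·y1)·B+(b11·x1+b21·y1)·C)/2, [T,Y]=x2·X−x1·Y+((c22·x1−c12·x2)·A+(c21·x1−c11·x2)·B+(−b21·x1+b11·x2)·C)/2−ρ·T,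 [X,Y]=ρ·X+θ₁·A+θ₂·B+θ₃·C+θ₄·T satisfies the Jacobi identity, and hence defines a 6-dimensional real Lie algebra containing span{A,B,C,T} ≅ sl(2,ℝ)⊕so(2) as a Lie subalgebra of codimension two. -/
/-- A 6-dimensional real Lie algebra realising the given bracket relations:
the Jacobi identity holds (it is a `LieRing`), the six listed elements form a basis,
and the span of `A, B, C, T` is a Lie subalgebra of codimension two. -/
structure SL2xSO2Family (b11 b21 c11 c12 c21 c22 x1 x2 y1 ρ θ4 : ℝ) where
  L : Type
  [lieRing : LieRing L]
  [lieAlgebra : LieAlgebra ℝ L]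
  A : L
  B : L
  C : L
  T : L
  X : L
  Y : L
  indep : LinearIndependent ℝ ![A, B, C, T, X, Y]
  span_top : Submodule.span ℝ ({A, B, C, T, X, Y} : Set L) = ⊤
  codim_two : Module.finrank ℝ (L ⧸ Submodule.span ℝ ({A, B, C, T} : Set L)) = 2
  hAB : ⁅A, B⁆ = (2:ℝ) • C
  hCA : ⁅C, A⁆ = (2:ℝ) • B
  hBC : ⁅B, C⁆ = -((2:ℝ) • A)
  hTA : ⁅T, A⁆ = 0
  hTB : ⁅T, B⁆ = 0
  hTC : ⁅T, C⁆ = 0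
  hAX : ⁅A, X⁆ = b11 • B + c11 • C
  hAY : ⁅A, Y⁆ = b21 • B + c21 • C
  hBX : ⁅B, X⁆ = b11 • A - c12 • C
  hBY : ⁅B, Y⁆ = b21 • A - c22 • C
  hCX : ⁅C, X⁆ = c11 • A + c12 • B
  hCY : ⁅C, Y⁆ = c21 • A + c22 • B
  hTX : ⁅T, X⁆ = x1 • X + y1 • Y + ((-c12*x1 - c22*y1)/2) • A +
      ((-c11*x1 - c21*y1)/2) • B + ((b11*x1 + b21*y1)/2) • C
  hTY : ⁅T, Y⁆ = x2 • X - x1 • Y + ((c22*x1 - c12*x2)/2) • A +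
      ((c21*x1 - c11*x2)/2) • B + ((-b21*x1 + b11*x2)/2) • C - ρ • T
  hXY : ⁅X, Y⁆ = ρ • X + ((-ρ*c12 - b11*c21 + b21*c11)/2) • A + ((-ρ*c11 - b11*c22 + b21*c12)/2) • B +
      ((ρ*b11 - c11*c22 + c12*c21)/2) • C + θ4 • T

/-- The underlying 6-dimensional space, with coordinates along `A, B, C, T, X, Y`. It is kept separate
from `Fin 6 → ℝ` so as not to inherit the pointwise bracket. -/
def SL2xSO2Carrier : Type := Fin 6 → ℝ

namespace SL2xSO2Carrier

instance : AddCommGroup SL2xSO2Carrier := inferInstanceAs (AddCommGroup (Fin 6 → ℝ))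

noncomputable instance : Module ℝ SL2xSO2Carrier := inferInstanceAs (Module ℝ (Fin 6 → ℝ))

/-- The identification of the carrier with `Fin 6 → ℝ`. -/
noncomputable def equivFun : SL2xSO2Carrier ≃ₗ[ℝ] (Fin 6 → ℝ) := LinearEquiv.refl ℝ _

/-- The standard basis `A, B, C, T, X, Y`. -/
noncomputable def basis : Module.Basis (Fin 6) ℝ SL2xSO2Carrier := Module.Basis.ofEquivFun equivFun

@[ext] theorem ext {u v : SL2xSO2Carrier} (h0 : u 0 = v 0) (h1 : u 1 = v 1) (h2 : u 2 = v 2)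
    (h3 : u 3 = v 3) (h4 : u 4 = v 4) (h5 : u 5 = v 5) : u = v := by
  funext i
  fin_cases i <;> assumption

@[simp] theorem equivFun_symm_apply (v : Fin 6 → ℝ) (i : Fin 6) : equivFun.symm v i = v i := rfl

@[simp] theorem add_apply (u v : SL2xSO2Carrier) (i : Fin 6) : (u + v) i = u i + v i := rfl

@[simp] theorem sub_apply (u v : SL2xSO2Carrier) (i : Fin 6) : (u - v) i = u i - v i := rfl

@[simp] theorem neg_apply (u : SL2xSO2Carrier) (i : Fin 6) : (-u) i = -u i := rfl

@[simp] theorem zero_apply (i : Fin 6) : (0 : SL2xSO2Carrier) i = 0 := rfl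

@[simp] theorem smul_apply (r : ℝ) (u : SL2xSO2Carrier) (i : Fin 6) : (r • u) i = r * u i := rfl

@[simp] theorem basis_apply (i j : Fin 6) : basis i j = if j = i then 1 else 0 := by
  have h : basis i = (Pi.single i 1 : Fin 6 → ℝ) := by
    simp only [basis, Module.Basis.coe_ofEquivFun]
    rfl
  rw [h, Pi.single_apply]

section Bracket

variable (b11 b21 c11 c12 c21 c22 x1 x2 y1 ρ θ4 : ℝ)

/-- The bracket of the family, in coordinates. The `2 × 2` minors of the coordinate vectors multiply
the brackets of the corresponding basis vectors. -/
noncomputable def bracket (u v : SL2xSO2Carrier) : SL2xSO2Carrier :=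
  let m : Fin 6 → Fin 6 → ℝ := fun i j => u i * v j - u j * v i
  equivFun.symm ![-2 * m 1 2 + b11 * m 1 4 + b21 * m 1 5 + c11 * m 2 4 + c21 * m 2 5
        + (-c12 * x1 - c22 * y1) / 2 * m 3 4 + (c22 * x1 - c12 * x2) / 2 * m 3 5
        + (-ρ * c12 - b11 * c21 + b21 * c11) / 2 * m 4 5,
      -2 * m 0 2 + b11 * m 0 4 + b21 * m 0 5 + c12 * m 2 4 + c22 * m 2 5
        + (-c11 * x1 - c21 * y1) / 2 * m 3 4 + (c21 * x1 - c11 * x2) / 2 * m 3 5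
        + (-ρ * c11 - b11 * c22 + b21 * c12) / 2 * m 4 5,
      2 * m 0 1 + c11 * m 0 4 + c21 * m 0 5 - c12 * m 1 4 - c22 * m 1 5
        + (b11 * x1 + b21 * y1) / 2 * m 3 4 + (-b21 * x1 + b11 * x2) / 2 * m 3 5
        + (ρ * b11 - c11 * c22 + c12 * c21) / 2 * m 4 5,
      -ρ * m 3 5 + θ4 * m 4 5,
      x1 * m 3 4 + x2 * m 3 5 + ρ * m 4 5,
      y1 * m 3 4 - x1 * m 3 5]

/-- The Lie ring structure given by `SL2xSO2Carrier.bracket`. -/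
@[reducible] noncomputable def lieRing : LieRing SL2xSO2Carrier where
  bracket := bracket b11 b21 c11 c12 c21 c22 x1 x2 y1 ρ θ4
  add_lie u v w := by
    ext <;> simp [bracket] <;> ring
  lie_add u v w := by
    ext <;> simp [bracket] <;> ring
  lie_self u := by
    ext <;> simp [bracket] <;> ring
  leibniz_lie u v w := by
    ext <;> simp [bracket] <;> ring

/-- The real Lie algebra structure given by `SL2xSO2Carrier.bracket`. -/
@[reducible] noncomputable def lieAlgebra :
    letI := lieRing b11 b21 c11 c12 c21 c22 x1 x2 y1 ρ θ4
    LieAlgebra ℝ SL2xSO2Carrier :=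
  letI := lieRing b11 b21 c11 c12 c21 c22 x1 x2 y1 ρ θ4
  { (inferInstance : Module ℝ SL2xSO2Carrier) with
    lie_smul := fun r u v => by
      ext <;> simp [Bracket.bracket, bracket] <;> ring }

end Bracket

theorem finrank_quotient_span :
    Module.finrank ℝ (SL2xSO2Carrier ⧸
      Submodule.span ℝ ({basis 0, basis 1, basis 2, basis 3} : Set SL2xSO2Carrier)) = 2 := by
  have hli : LinearIndependent ℝ (basis ∘ (Fin.castLE (by norm_num) : Fin 4 → Fin 6)) :=
    basis.linearIndependent.comp _ (Fin.castLE_injective _)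
  have hrange : Set.range (basis ∘ (Fin.castLE (by norm_num) : Fin 4 → Fin 6)) =
      {basis 0, basis 1, basis 2, basis 3} := by
    ext v
    simp [Fin.exists_fin_succ, eq_comm]
  have hspan := finrank_span_eq_card hli
  rw [hrange] at hspan
  have : Module.Finite ℝ SL2xSO2Carrier := Module.Finite.of_basis basis
  have htotal := Module.finrank_eq_card_basis basis
  have := Submodule.finrank_quotient_add_finrank
    (Submodule.span ℝ ({basis 0, basis 1, basis 2, basis 3} : Set SL2xSO2Carrier))
  simp only [Fintype.card_fin] at hspan htotal
  omega

theorem basis_vec : ![basis 0, basis 1, basis 2, basis 3, basis 4, basis 5] = ⇑basis := by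
  funext i
  fin_cases i <;> rfl

theorem span_basis_vectors :
    Submodule.span ℝ ({basis 0, basis 1, basis 2, basis 3, basis 4, basis 5} :
      Set SL2xSO2Carrier) = ⊤ := by
  rw [← basis.span_eq, ← basis_vec]
  congr 1
  simp only [Matrix.range_cons, Matrix.range_empty, Set.union_empty, Set.singleton_union]
  rfl

end SL2xSO2Carrier

open SL2xSO2Carrier in
theorem stmt_17 (b11 b21 c11 c12 c21 c22 x1 x2 y1 ρ θ4 : ℝ) :
    Nonempty (SL2xSO2Family b11 b21 c11 c12 c21 c22 x1 x2 y1 ρ θ4) := by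
  let _ := lieRing b11 b21 c11 c12 c21 c22 x1 x2 y1 ρ θ4
  let _ := lieAlgebra b11 b21 c11 c12 c21 c22 x1 x2 y1 ρ θ4
  have hlie (u v : SL2xSO2Carrier) :
      ⁅u, v⁆ = bracket b11 b21 c11 c12 c21 c22 x1 x2 y1 ρ θ4 u v := rfl
  refine ⟨{
    L := SL2xSO2Carrier
    A := basis 0
    B := basis 1
    C := basis 2
    T := basis 3
    X := basis 4
    Y := basis 5
    indep := basis_vec ▸ basis.linearIndependent
    span_top := span_basis_vectors
    codim_two := finrank_quotient_span
    hAB := ?_, hCA := ?_, hBC := ?_, hTA := ?_, hTB := ?_, hTC := ?_, hAX := ?_, hAY := ?_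
    hBX := ?_, hBY := ?_, hCX := ?_, hCY := ?_, hTX := ?_, hTY := ?_, hXY := ?_ }⟩
  all_goals
    ext <;> simp [hlie, bracket]
end
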